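/- arXiv:1407.6178 — 2 statements merged into one kernel-verified Lean document; each statement's English description precedes it below -/
import Mathlib

section
/- Let G = (V,E) be a strongly connected finite simple directed graph and let v₀, v₁, …, v_l be distinct vertices of G such that v₀ ↔² v_l and v_{i−1} ↔² v_i for every i ∈ {1, 2, …, l}. Then all the vertices v₀, v₁, …, v_l lie in the same 2-directed block of G. -/
variable {V : Type*}

/-- `p` is a simple directed path from `x` to `y` w.r.t. the edge relation `E`. -/
def IsDipath (E : V → V → Prop) (x y : V) (p : List V) : Prop :=
  List.Chain' E p ∧ p.head? = some x ∧ p.getLast? = some y ∧ p.Nodup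

/-- The edges of a path, as the list of consecutive pairs. -/
def dipathEdges (p : List V) : List (V × V) := p.zip p.tail

/-- There are two (distinct, internally vertex-disjoint) paths from `x` to `y`:
they share no vertices other than `x` and `y`. -/
def TwoVDP (E : V → V → Prop) (x y : V) : Prop :=
  ∃ p q : List V, IsDipath E x y p ∧ IsDipath E x y q ∧ p ≠ q ∧
    ∀ z, z ∈ p → z ∈ q → z = x ∨ z = y

/-- There are two edge-disjoint paths from `x` to `y`. -/
def TwoEDP (E : V → V → Prop) (x y : V) : Prop :=
  ∃ p q : List V, IsDipath E x y p ∧ IsDipath E x y q ∧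
    ∀ e, e ∈ dipathEdges p → e ∉ dipathEdges q

/-- Reachability in a digraph. -/
def DiReach (E : V → V → Prop) (x y : V) : Prop := Relation.ReflTransGen E x y

/-- `x` and `y` lie in the same strongly connected component. -/
def InSameSCC (E : V → V → Prop) (x y : V) : Prop := DiReach E x y ∧ DiReach E y x

/-- The digraph is strongly connected. -/
def IsStronglyConn (E : V → V → Prop) : Prop := ∀ x y, DiReach E x y

/-- Deleting a vertex `w` (and its incident edges). -/
def DelVertex (E : V → V → Prop) (w : V) : V → V → Prop :=
  fun a b => E a b ∧ a ≠ w ∧ b ≠ w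

/-- `x ↔² y` : two vertex-disjoint paths in both directions. -/
def Rel2d (E : V → V → Prop) (x y : V) : Prop :=
  x ≠ y ∧ TwoVDP E x y ∧ TwoVDP E y x

/-- `x ↔^{2s} y`. -/
def Rel2s (E : V → V → Prop) (x y : V) : Prop :=
  x ≠ y ∧ ∀ z, z ≠ x → z ≠ y → InSameSCC (DelVertex E z) x y

/-- `x ↔^{2e} y` : two edge-disjoint paths in both directions. -/
def Rel2e (E : V → V → Prop) (x y : V) : Prop :=
  x ≠ y ∧ TwoEDP E x y ∧ TwoEDP E y x

/-- A maximal vertex set of size ≥ `k` all of whose pairs of distinct elements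
satisfy the relation `R` (e.g. a 2-directed/2-strong/2-edge block). -/
def IsMaxBlock (R : V → V → Prop) (k : ℕ) (C : Set V) : Prop :=
  k ≤ C.ncard ∧ (∀ x ∈ C, ∀ y ∈ C, x ≠ y → R x y) ∧
    ∀ D : Set V, C ⊆ D → (∀ x ∈ D, ∀ y ∈ D, x ≠ y → R x y) → D = C

theorem rtg_mono {R Q : V → V → Prop} {a b : V} (hr : Relation.ReflTransGen R a b)
    (h : ∀ c d, R c d → Q c d) : Relation.ReflTransGen Q a b :=
  Relation.ReflTransGen.mono h _ _ hr

/-- Edges restricted to a vertex set. -/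
def RsE (E : V → V → Prop) (S : Set V) : V → V → Prop :=
  fun a b => E a b ∧ a ∈ S ∧ b ∈ S

/-- Some vertex of `A` reaches some vertex of `B` inside `S`. -/
def ConnE (E : V → V → Prop) (A B S : Set V) : Prop :=
  ∃ a b, a ∈ A ∧ a ∈ S ∧ b ∈ B ∧ Relation.ReflTransGen (RsE E S) a b

theorem RsE_mono {E F : V → V → Prop} {S T : Set V} (h : ∀ a b, E a b → F a b) (hS : S ⊆ T)
    {a b : V} (hr : Relation.ReflTransGen (RsE E S) a b) :
    Relation.ReflTransGen (RsE F T) a b :=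
  rtg_mono hr fun _ _ ⟨h1, h2, h3⟩ => ⟨h _ _ h1, hS h2, hS h3⟩

theorem RsE_mem {E : V → V → Prop} {S : Set V} {a b : V} (ha : a ∈ S)
    (hr : Relation.ReflTransGen (RsE E S) a b) : b ∈ S := by
  induction hr with
  | refl => exact ha
  | tail _ h _ => exact h.2.2

theorem RsE_mem' {E : V → V → Prop} {S : Set V} {a b : V} (hb : b ∈ S)
    (hr : Relation.ReflTransGen (RsE E S) a b) : a ∈ S := by
  induction hr using Relation.ReflTransGen.head_induction_on with
  | refl => exact hb
  | head h _ _ => exact h.2.1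

/-- First hitting: going from `a` to `b`, we either reach `b` without ever touching `K`, or there
is a prefix ending at the first element of `K`. -/
theorem first_hit {E : V → V → Prop} {S K : Set V} {a b : V} (ha : a ∈ S)
    (hr : Relation.ReflTransGen (RsE E S) a b) :
    (a ∉ K ∧ Relation.ReflTransGen (RsE E (S \ K)) a b) ∨
    ∃ k ∈ K, k ∈ S ∧ Relation.ReflTransGen
      (fun c d => RsE E S c d ∧ c ∉ K) a k := by
  induction hr with
  | refl =>
    by_cases h : a ∈ K
    · exact Or.inr ⟨a, h, ha, .refl⟩
    · exact Or.inl ⟨h, .refl⟩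
  | @tail b c hab hbc ih =>
    rcases ih with ⟨h1, h2⟩ | h
    · have hb : b ∈ S \ K := RsE_mem ⟨ha, h1⟩ h2
      by_cases hc : c ∈ K
      · refine Or.inr ⟨c, hc, hbc.2.2, ?_⟩
        refine Relation.ReflTransGen.tail (rtg_mono h2 ?_) ⟨hbc, hb.2⟩
        rintro p q ⟨h3, h4, h5⟩
        exact ⟨⟨h3, h4.1, h5.1⟩, h4.2⟩
      · exact Or.inl ⟨h1, h2.tail ⟨hbc.1, hb, hbc.2.2, hc⟩⟩
    · exact Or.inr h

theorem last_hit {E : V → V → Prop} {S K : Set V} {a b : V} (hb : b ∈ S)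
    (hr : Relation.ReflTransGen (RsE E S) a b) :
    (b ∉ K ∧ Relation.ReflTransGen (RsE E (S \ K)) a b) ∨
    ∃ k ∈ K, k ∈ S ∧ Relation.ReflTransGen
      (fun c d => RsE E S c d ∧ d ∉ K) k b := by
  induction hr using Relation.ReflTransGen.head_induction_on with
  | refl =>
    by_cases h : b ∈ K
    · exact Or.inr ⟨b, h, hb, .refl⟩
    · exact Or.inl ⟨h, .refl⟩
  | @head a c hac hcb ih =>
    rcases ih with ⟨h1, h2⟩ | h
    · have hc : c ∈ S \ K := RsE_mem' ⟨hb, h1⟩ h2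
      by_cases ha : a ∈ K
      · refine Or.inr ⟨a, ha, hac.2.1, ?_⟩
        refine Relation.ReflTransGen.head ⟨hac, hc.2⟩ (rtg_mono h2 ?_)
        rintro p q ⟨h3, h4, h5⟩
        exact ⟨⟨h3, h4.1, h5.1⟩, h5.2⟩
      · exact Or.inl ⟨h1, h2.head ⟨hac.1, ⟨hac.2.1, ha⟩, hc⟩⟩
    · exact Or.inr h

/-- Everything on a walk is reachable from the start. -/
theorem RsE_reach {E : V → V → Prop} {S : Set V} {A : Set V} {U : Set V} {a b : V}
    (ha : a ∈ A) (haU : a ∈ U)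
    (hr : Relation.ReflTransGen (RsE E (S ∩ U)) a b) :
    Relation.ReflTransGen (RsE E (S ∩ {z | ∃ a ∈ A, a ∈ U ∧
      Relation.ReflTransGen (RsE E U) a z})) a b := by
  have key : ∀ c, Relation.ReflTransGen (RsE E (S ∩ U)) a c →
      c ∈ {z | ∃ a ∈ A, a ∈ U ∧ Relation.ReflTransGen (RsE E U) a z} := fun c hc =>
    ⟨a, ha, haU, RsE_mono (fun _ _ h => h) Set.inter_subset_right hc⟩
  induction hr with
  | refl => exact .refl
  | tail h1 h2 ih =>
    exact ih.tail ⟨h2.1, ⟨h2.2.1.1, key _ h1⟩, ⟨h2.2.2.1, key _ (h1.tail h2)⟩⟩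

theorem RsE_reach' {E : V → V → Prop} {S : Set V} {A : Set V} {U : Set V} {a b : V}
    (ha : b ∈ A) (haU : b ∈ U)
    (hr : Relation.ReflTransGen (RsE E (S ∩ U)) a b) :
    Relation.ReflTransGen (RsE E (S ∩ {z | ∃ a ∈ A, a ∈ U ∧
      Relation.ReflTransGen (RsE E U) z a})) a b := by
  have key : ∀ c, Relation.ReflTransGen (RsE E (S ∩ U)) c b →
      c ∈ {z | ∃ a ∈ A, a ∈ U ∧ Relation.ReflTransGen (RsE E U) z a} := fun c hc =>
    ⟨b, ha, haU, RsE_mono (fun _ _ h => h) Set.inter_subset_right hc⟩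
  induction hr using Relation.ReflTransGen.head_induction_on with
  | refl => exact .refl
  | head h2 h1 ih =>
    exact ih.head ⟨h2.1, ⟨h2.2.1.1, key _ (h1.head h2)⟩, ⟨h2.2.2.1, key _ h1⟩⟩

/-- A walk in `S` from `A` to `s`, trimmed at first visit of `s`. -/
theorem trim_to {E : V → V → Prop} {S A : Set V} {a s : V} (ha : a ∈ A) (haS : a ∈ S)
    (hr : Relation.ReflTransGen (RsE E S) a s) :
    Relation.ReflTransGen (RsE E (S ∩ ({z | ∃ a ∈ A, a ∈ ({s}ᶜ : Set V) ∧
      Relation.ReflTransGen (RsE E {s}ᶜ) a z} ∪ {s}))) a s := by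
  have hs : s ∈ S := RsE_mem haS hr
  by_cases has : a = s
  · subst has; exact .refl
  have key : ∀ c, Relation.ReflTransGen (RsE E S) a c →
      (Relation.ReflTransGen (RsE E (S ∩ {s}ᶜ)) a c) ∨
      Relation.ReflTransGen (RsE E (S ∩ ({z | ∃ a ∈ A, a ∈ ({s}ᶜ : Set V) ∧
      Relation.ReflTransGen (RsE E {s}ᶜ) a z} ∪ {s}))) a s := by
    intro c hc
    induction hc with
    | refl => exact Or.inl .refl
    | @tail c d h1 h2 ih =>
      rcases ih with ih | ih
      · have hc : c ∈ S ∩ {s}ᶜ := RsE_mem ⟨haS, has⟩ ih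
        by_cases hd : d = s
        · subst hd
          right
          refine Relation.ReflTransGen.tail (RsE_mono (fun _ _ h => h) ?_
            (RsE_reach ha has ih)) ⟨h2.1, ⟨hc.1, Or.inl ?_⟩, hs, Or.inr rfl⟩
          · exact Set.inter_subset_inter_right _ Set.subset_union_left
          · exact ⟨a, ha, has, RsE_mono (fun _ _ h => h) Set.inter_subset_right ih⟩
        · exact Or.inl (ih.tail ⟨h2.1, hc, h2.2.2, hd⟩)
      · exact Or.inr ih
  rcases key s hr with h | h
  · exact absurd rfl (RsE_mem (S := S ∩ {s}ᶜ) ⟨haS, has⟩ h).2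
  · exact h

theorem trim_from {E : V → V → Prop} {S A : Set V} {a s : V} (ha : a ∈ A) (haS : a ∈ S)
    (hr : Relation.ReflTransGen (RsE E S) s a) :
    Relation.ReflTransGen (RsE E (S ∩ ({z | ∃ a ∈ A, a ∈ ({s}ᶜ : Set V) ∧
      Relation.ReflTransGen (RsE E {s}ᶜ) z a} ∪ {s}))) s a := by
  have hs : s ∈ S := RsE_mem' haS hr
  by_cases has : a = s
  · subst has; exact .refl
  have key : ∀ c, Relation.ReflTransGen (RsE E S) c a →
      (Relation.ReflTransGen (RsE E (S ∩ {s}ᶜ)) c a) ∨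
      Relation.ReflTransGen (RsE E (S ∩ ({z | ∃ a ∈ A, a ∈ ({s}ᶜ : Set V) ∧
      Relation.ReflTransGen (RsE E {s}ᶜ) z a} ∪ {s}))) s a := by
    intro c hc
    induction hc using Relation.ReflTransGen.head_induction_on with
    | refl => exact Or.inl .refl
    | @head d c h2 h1 ih =>
      rcases ih with ih | ih
      · have hc : c ∈ S ∩ {s}ᶜ := RsE_mem' ⟨haS, has⟩ ih
        by_cases hd : d = s
        · subst hd
          right
          refine Relation.ReflTransGen.head ⟨h2.1, ⟨hs, Or.inr rfl⟩, hc.1, Or.inl ?_⟩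
            (RsE_mono (fun _ _ h => h) ?_ (RsE_reach' ha has ih))
          · exact ⟨a, ha, has, RsE_mono (fun _ _ h => h) Set.inter_subset_right ih⟩
          · exact Set.inter_subset_inter_right _ Set.subset_union_left
        · exact Or.inl (ih.head ⟨h2.1, ⟨h2.2.1, hd⟩, hc⟩)
      · exact Or.inr ih
  rcases key s hr with h | h
  · exact absurd rfl (RsE_mem' (S := S ∩ {s}ᶜ) ⟨haS, has⟩ h).2
  · exact h

/-- Menger's theorem for `k = 2`, set version (Göring's proof). -/
theorem menger_two [Finite V] [Nonempty V] (n : ℕ) : ∀ (E : V → V → Prop) (A B : Set V),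
    {e : V × V | E e.1 e.2}.ncard = n → (∀ w, ConnE E A B {w}ᶜ) →
    ∃ S T : Set V, Disjoint S T ∧ ConnE E A B S ∧ ConnE E A B T := by
  induction n with
  | zero =>
    intro E A B hn h
    have hE : ∀ a b, ¬ E a b := by
      intro a b hab
      rw [Set.ncard_eq_zero] at hn
      have : (a, b) ∈ {e : V × V | E e.1 e.2} := hab
      rw [hn] at this
      exact this
    have hR : ∀ (S : Set V) a b, Relation.ReflTransGen (RsE E S) a b → a = b := by
      intro S a b hab
      cases hab using Relation.ReflTransGen.head_induction_on with
      | refl => rfl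
      | head h _ => exact absurd h.1 (hE _ _)
    obtain ⟨w⟩ := ‹Nonempty V›
    obtain ⟨a, b, ha, -, hb, hab⟩ := h w
    obtain rfl := hR _ _ _ hab
    obtain ⟨c, d, hc, hca, hd, hcd⟩ := h a
    obtain rfl := hR _ _ _ hcd
    exact ⟨{a}, {c}, by simpa using fun h => hca h.symm, ⟨a, a, ha, rfl, hb, .refl⟩,
      ⟨c, c, hc, rfl, hd, .refl⟩⟩
  | succ n ih =>
    intro E A B hn h
    obtain ⟨⟨u, v⟩, huv⟩ : {e : V × V | E e.1 e.2}.Nonempty := by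
      rw [Set.nonempty_iff_ne_empty]
      intro h0
      simp [h0] at hn
    have huv : E u v := huv
    obtain ⟨E', hE'⟩ : ∃ E' : V → V → Prop, ∀ c d, E' c d ↔ E c d ∧ ¬ (c = u ∧ d = v) :=
      ⟨_, fun _ _ => Iff.rfl⟩
    have hsub : ∀ c d, E' c d → E c d := fun c d hcd => ((hE' c d).1 hcd).1
    have hn' : {e : V × V | E' e.1 e.2}.ncard = n := by
      have : {e : V × V | E' e.1 e.2} = {e : V × V | E e.1 e.2} \ {(u, v)} := by
        ext ⟨c, d⟩
        simp [hE']
      rw [this, Set.ncard_sdiff_singleton_of_mem (show (u, v) ∈ {e : V × V | E e.1 e.2} from huv), hn]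
      rfl
    by_cases hall : ∀ w, ConnE E' A B {w}ᶜ
    · obtain ⟨S, T, hd, ⟨a, b, h1, h2, h3, h4⟩, ⟨a', b', h1', h2', h3', h4'⟩⟩ := ih E' A B hn' hall
      exact ⟨S, T, hd, ⟨a, b, h1, h2, h3, RsE_mono hsub subset_rfl h4⟩,
        ⟨a', b', h1', h2', h3', RsE_mono hsub subset_rfl h4'⟩⟩
    push Not at hall
    obtain ⟨s, hs⟩ := hall
    -- the separator is `s`
    have hAu : ∀ w, ConnE E' A {s, u} {w}ᶜ := by
      intro w
      obtain ⟨a, b, ha, haw, hb, hab⟩ := h w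
      rcases first_hit (K := {s, u}) haw hab with ⟨h1, h2⟩ | ⟨k, hk, hkS, h2⟩
      · refine absurd ⟨a, b, ha, ?_, hb, rtg_mono h2 ?_⟩ hs
        · intro h3
          exact h1 (Or.inl h3)
        · rintro c d ⟨h3, h4, h5⟩
          refine ⟨(hE' c d).2 ⟨h3, fun h6 => h4.2 (Or.inr h6.1)⟩, fun h6 => h4.2 (Or.inl h6),
            fun h6 => h5.2 (Or.inl h6)⟩
      · refine ⟨a, k, ha, haw, hk, rtg_mono h2 ?_⟩
        rintro c d ⟨h3, h4⟩
        exact ⟨(hE' c d).2 ⟨h3.1, fun h6 => h4 (Or.inr h6.1)⟩, h3.2⟩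
    have hvB : ∀ w, ConnE E' {s, v} B {w}ᶜ := by
      intro w
      obtain ⟨a, b, ha, haw, hb, hab⟩ := h w
      have hbw := RsE_mem haw hab
      rcases last_hit (K := {s, v}) hbw hab with ⟨h1, h2⟩ | ⟨k, hk, hkS, h2⟩
      · have h1' := RsE_mem' (S := {w}ᶜ \ {s, v}) ⟨hbw, h1⟩ h2
        refine absurd ⟨a, b, ha, ?_, hb, rtg_mono h2 ?_⟩ hs
        · intro h3
          exact h1'.2 (Or.inl h3)
        · rintro c d ⟨h3, h4, h5⟩
          refine ⟨(hE' c d).2 ⟨h3, fun h6 => h5.2 (Or.inr h6.2)⟩, fun h6 => h4.2 (Or.inl h6),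
            fun h6 => h5.2 (Or.inl h6)⟩
      · refine ⟨k, b, hk, hkS, hb, rtg_mono h2 ?_⟩
        rintro c d ⟨h3, h4⟩
        exact ⟨(hE' c d).2 ⟨h3.1, fun h6 => h4 (Or.inr h6.2)⟩, h3.2⟩
    have hA2 : ∃ S T : Set V, Disjoint S T ∧
        (∃ a, a ∈ A ∧ a ∈ S ∧ Relation.ReflTransGen (RsE E' S) a s) ∧
        (∃ a, a ∈ A ∧ a ∈ T ∧ Relation.ReflTransGen (RsE E' T) a u) := by
      obtain ⟨S, T, hd, ⟨a, b, h1, h2, h3, h4⟩, ⟨a', b', h1', h2', h3', h4'⟩⟩ :=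
        ih E' A _ hn' hAu
      have hb := RsE_mem h2 h4
      have hb' := RsE_mem h2' h4'
      have hne : b ≠ b' := fun h0 => Set.disjoint_left.1 hd hb (h0 ▸ hb')
      rcases h3 with rfl | h3
      · rcases h3' with rfl | h3'
        · exact absurd rfl hne
        · obtain rfl : b' = u := h3'
          exact ⟨S, T, hd, ⟨a, h1, h2, h4⟩, ⟨a', h1', h2', h4'⟩⟩
      · obtain rfl : b = u := h3
        rcases h3' with rfl | h3'
        · exact ⟨T, S, hd.symm, ⟨a', h1', h2', h4'⟩, ⟨a, h1, h2, h4⟩⟩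
        · exact absurd (h3' : b' = b).symm hne
    have hB2 : ∃ S T : Set V, Disjoint S T ∧
        (∃ b, b ∈ B ∧ s ∈ S ∧ Relation.ReflTransGen (RsE E' S) s b) ∧
        (∃ b, b ∈ B ∧ v ∈ T ∧ Relation.ReflTransGen (RsE E' T) v b) := by
      obtain ⟨S, T, hd, ⟨b, a, h3, hb, h1, h4⟩, ⟨b', a', h3', hb', h1', h4'⟩⟩ :=
        ih E' _ B hn' hvB
      have hne : b ≠ b' := fun h0 => Set.disjoint_left.1 hd hb (h0 ▸ hb')
      rcases h3 with rfl | h3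
      · rcases h3' with rfl | h3'
        · exact absurd rfl hne
        · obtain rfl : b' = v := h3'
          exact ⟨S, T, hd, ⟨a, h1, hb, h4⟩, ⟨a', h1', hb', h4'⟩⟩
      · obtain rfl : b = v := h3
        rcases h3' with rfl | h3'
        · exact ⟨T, S, hd.symm, ⟨a', h1', hb', h4'⟩, ⟨a, h1, hb, h4⟩⟩
        · exact absurd (h3' : b' = b).symm hne
    obtain ⟨S1, T1, hd1, ⟨a, haA, haS, has⟩, ⟨a', haA', haT, hau⟩⟩ := hA2
    obtain ⟨S2, T2, hd2, ⟨b, hbB, hsS, hsb⟩, ⟨b', hbB', hvT, hvb⟩⟩ := hB2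
    have hbS := RsE_mem hsS hsb
    have hbT := RsE_mem hvT hvb
    have hsS1 := RsE_mem haS has
    have hsT1 : s ∉ T1 := Set.disjoint_left.1 hd1 hsS1
    have hsT2 : s ∉ T2 := Set.disjoint_left.1 hd2 hsS
    have e1 := trim_to haA haS has
    have e2 := trim_from hbB hbS hsb
    have f1 := RsE_reach (A := A) (S := T1) (U := {s}ᶜ) haA' (fun h0 => hsT1 (h0 ▸ haT))
      (RsE_mono (F := E') (fun _ _ h => h) (T := T1 ∩ {s}ᶜ)
        (fun z hz => ⟨hz, fun h0 : z = s => hsT1 (h0 ▸ hz)⟩) hau)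
    have f2 := RsE_reach' (A := B) (S := T2) (U := {s}ᶜ) hbB' (fun h0 => hsT2 (h0 ▸ hbT))
      (RsE_mono (F := E') (fun _ _ h => h) (T := T2 ∩ {s}ᶜ)
        (fun z hz => ⟨hz, fun h0 : z = s => hsT2 (h0 ▸ hz)⟩) hvb)
    set X := {z | ∃ a ∈ A, a ∈ ({s}ᶜ : Set V) ∧ Relation.ReflTransGen (RsE E' {s}ᶜ) a z} with hX
    set Y := {z | ∃ a ∈ B, a ∈ ({s}ᶜ : Set V) ∧ Relation.ReflTransGen (RsE E' {s}ᶜ) z a} with hY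
    have hXY : ∀ z, z ∈ X → z ∈ Y → False := by
      rintro z ⟨p, hp, hp', hpz⟩ ⟨q, hq, hq', hzq⟩
      exact hs ⟨p, q, hp, hp', hq, hpz.trans hzq⟩
    have hsX : s ∉ X := by
      rintro ⟨p, hp, hp', hpz⟩
      exact RsE_mem hp' hpz rfl
    have hsY : s ∉ Y := by
      rintro ⟨p, hp, hp', hpz⟩
      exact RsE_mem' hp' hpz rfl
    have haX : a' ∈ X := ⟨a', haA', fun h0 => hsT1 (h0 ▸ haT), .refl⟩
    have hbY : b' ∈ Y := ⟨b', hbB', fun h0 => hsT2 (h0 ▸ hbT), .refl⟩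
    have huX : u ∈ T1 ∩ X := RsE_mem ⟨haT, haX⟩ f1
    have hvY : v ∈ T2 ∩ Y := RsE_mem' ⟨hbT, hbY⟩ f2
    have haX' : a ∈ X ∪ {s} := (RsE_mem' (S := S1 ∩ (X ∪ {s})) ⟨hsS1, Or.inr rfl⟩ e1).2
    refine ⟨(S1 ∩ (X ∪ {s})) ∪ (S2 ∩ (Y ∪ {s})), (T1 ∩ X) ∪ (T2 ∩ Y), ?_,
      ⟨a, b, haA, Or.inl ⟨haS, haX'⟩, hbB, ?_⟩, ⟨a', b', haA', Or.inl ⟨haT, haX⟩, hbB', ?_⟩⟩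
    · rw [Set.disjoint_left]
      rintro z (⟨h1, h2 | rfl⟩ | ⟨h1, h2 | rfl⟩) (⟨h3, h4⟩ | ⟨h3, h4⟩)
      · exact Set.disjoint_left.1 hd1 h1 h3
      · exact hXY _ h2 h4
      · exact hsX h4
      · exact hsY h4
      · exact hXY _ h4 h2
      · exact Set.disjoint_left.1 hd2 h1 h3
      · exact hsX h4
      · exact hsY h4
    · exact (RsE_mono hsub Set.subset_union_left e1).trans
        (RsE_mono hsub Set.subset_union_right e2)
    · exact ((RsE_mono hsub Set.subset_union_left f1).tail
        ⟨huv, Or.inl huX, Or.inr hvY⟩).trans (RsE_mono hsub Set.subset_union_right f2)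

/-- Extraction of a simple path. -/
theorem exists_dipath {E : V → V → Prop} {S : Set V} {a b : V} (hb : b ∈ S)
    (hr : Relation.ReflTransGen (RsE E S) a b) :
    ∃ p, IsDipath E a b p ∧ ∀ z ∈ p, z ∈ S := by
  induction hr using Relation.ReflTransGen.head_induction_on with
  | refl => exact ⟨[b], ⟨List.isChain_singleton _, rfl, rfl, by simp⟩, by simpa using hb⟩
  | @head a c h1 h2 ih =>
    obtain ⟨p, ⟨q1, q2, q3, q4⟩, hS⟩ := ih
    by_cases hap : a ∈ p
    · obtain ⟨l1, l2, rfl⟩ := List.append_of_mem hap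
      refine ⟨a :: l2, ⟨?_, rfl, ?_, ?_⟩, ?_⟩
      · exact List.IsChain.right_of_append q1
      · simpa using q3
      · exact (List.nodup_append.1 q4).2.1
      · intro z hz
        exact hS z (List.mem_append_right _ hz)
    · refine ⟨a :: p, ⟨?_, rfl, ?_, ?_⟩, ?_⟩
      · cases p with
        | nil => simp at q2
        | cons d p =>
          simp at q2
          subst q2
          exact List.IsChain.cons_cons h1.1 q1
      · cases p with
        | nil => simp at q2
        | cons d p => simpa using q3
      · exact List.nodup_cons.2 ⟨hap, q4⟩
      · intro z hz
        rcases List.mem_cons.1 hz with rfl | hz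
        · exact h1.2.1
        · exact hS z hz

theorem chain_reach {E : V → V → Prop} {S : Set V} {b : V} (p : List V) :
    ∀ a, List.IsChain E p → p.head? = some a → p.getLast? = some b → (∀ z ∈ p, z ∈ S) →
    Relation.ReflTransGen (RsE E S) a b := by
  induction p with
  | nil => intro a _ h; simp at h
  | cons c p ih =>
    intro a h1 h2 h3 h4
    simp at h2
    subst h2
    cases p with
    | nil =>
      simp at h3
      subst h3
      exact .refl
    | cons d p =>
      rw [List.isChain_cons_cons] at h1
      refine Relation.ReflTransGen.head ⟨h1.1, h4 _ (by simp), h4 _ (by simp)⟩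
        (ih d h1.2 rfl (by simpa using h3) fun z hz => h4 z (List.mem_cons_of_mem _ hz))

theorem TwoVDP.avoid {E : V → V → Prop} {a b w : V} (h : TwoVDP E a b) (ha : w ≠ a)
    (hb : w ≠ b) : Relation.ReflTransGen (RsE E {w}ᶜ) a b := by
  obtain ⟨p, q, ⟨p1, p2, p3, -⟩, ⟨q1, q2, q3, -⟩, -, hd⟩ := h
  by_cases hw : w ∈ p
  · have hq : w ∉ q := fun hq => (hd w hw hq).elim ha hb
    exact chain_reach q a q1 q2 q3 fun z hz h0 => hq (h0 ▸ hz)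
  · exact chain_reach p a p1 p2 p3 fun z hz h0 => hw (h0 ▸ hz)

theorem split_ends {F : V → V → Prop} {x y : V} (hxy : x ≠ y) (hF : ¬ F x y)
    (hr : Relation.ReflTransGen F x y) :
    ∃ a b, F x a ∧ F b y ∧ a ∈ ({x, y}ᶜ : Set V) ∧
      Relation.ReflTransGen (RsE F {x, y}ᶜ) a b := by
  have key : ∀ z, Relation.ReflTransGen F x z → z = x ∨
      (∃ a, F x a ∧ a ∈ ({x, y}ᶜ : Set V) ∧ Relation.ReflTransGen (RsE F {x, y}ᶜ) a z) ∨
      (∃ a b, F x a ∧ F b y ∧ a ∈ ({x, y}ᶜ : Set V) ∧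
        Relation.ReflTransGen (RsE F {x, y}ᶜ) a b) := by
    intro z hz
    induction hz with
    | refl => exact Or.inl rfl
    | @tail z t h1 h2 ih =>
      by_cases htx : t = x
      · exact Or.inl htx
      rcases ih with rfl | ⟨a, h3, h4, h5⟩ | h
      · have hty : t ≠ y := by rintro rfl; exact hF h2
        exact Or.inr (Or.inl ⟨t, h2, by simp [htx, hty], .refl⟩)
      · by_cases hty : t = y
        · subst hty
          exact Or.inr (Or.inr ⟨a, z, h3, h2, h4, h5⟩)
        · exact Or.inr (Or.inl ⟨a, h3, h4, h5.tail ⟨h2, RsE_mem h4 h5, by simp [htx, hty]⟩⟩)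
      · exact Or.inr (Or.inr h)
  rcases key y hr with h | ⟨a, h3, h4, h5⟩ | h
  · exact absurd h.symm hxy
  · exact absurd (Or.inr rfl) (RsE_mem h4 h5)
  · exact h

theorem twoVDP_of [Finite V] {E : V → V → Prop} {x y : V} (hxy : x ≠ y)
    (hw : ∀ w, w ≠ x → w ≠ y → Relation.ReflTransGen (RsE E {w}ᶜ) x y)
    (he : Relation.ReflTransGen (fun c d => E c d ∧ ¬ (c = x ∧ d = y)) x y) :
    TwoVDP E x y := by
  have : Nonempty V := ⟨x⟩
  by_cases hE : E x y
  · obtain ⟨p, ⟨p1, p2, p3, p4⟩, -⟩ := exists_dipath (S := Set.univ) (Set.mem_univ y)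
      (rtg_mono he fun c d h => (⟨h, trivial, trivial⟩ : RsE _ Set.univ c d))
    refine ⟨p, [x, y], ⟨List.IsChain.imp (fun _ _ h => h.1) p1, p2, p3, p4⟩,
      ⟨?_, rfl, rfl, ?_⟩, ?_, ?_⟩
    · exact List.isChain_pair.2 hE
    · simp [hxy]
    · rintro rfl
      exact (List.isChain_pair.1 p1).2 ⟨rfl, rfl⟩
    · intro z _ hz
      simpa using hz
  · have hc : ∀ w, ConnE (RsE E {x, y}ᶜ) {a | E x a ∧ a ∈ ({x, y}ᶜ : Set V)}
        {b | E b y ∧ b ∈ ({x, y}ᶜ : Set V)} {w}ᶜ := by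
      intro w
      by_cases h : w ≠ x ∧ w ≠ y
      · obtain ⟨a, b, h1, h2, h3, h4⟩ := split_ends hxy (fun h => hE h.1) (hw w h.1 h.2)
        have hb := RsE_mem h3 h4
        refine ⟨a, b, ⟨h1.1, h3⟩, h1.2.2, ⟨h2.1, hb⟩, rtg_mono h4 ?_⟩
        rintro c d ⟨h5, h6⟩
        exact ⟨⟨h5.1, h6⟩, h5.2⟩
      · have hwm : w ∈ ({x, y} : Set V) := by
          by_contra h0
          exact h ⟨fun h1 => h0 (Or.inl h1), fun h1 => h0 (Or.inr h1)⟩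
        obtain ⟨a, b, h1, h2, h3, h4⟩ := split_ends hxy (fun h => hE h.1) he
        have hb := RsE_mem h3 h4
        refine ⟨a, b, ⟨h1.1, h3⟩, fun h0 => h3 (h0 ▸ hwm), ⟨h2.1, hb⟩, rtg_mono h4 ?_⟩
        rintro c d ⟨h5, h6⟩
        exact ⟨⟨h5.1, h6⟩, fun h0 => h6.1 (h0 ▸ hwm), fun h0 => h6.2 (h0 ▸ hwm)⟩
    obtain ⟨S, T, hd, hS, hT⟩ := menger_two _ _ _ _ rfl hc
    have build : ∀ S : Set V, ConnE (RsE E {x, y}ᶜ) {a | E x a ∧ a ∈ ({x, y}ᶜ : Set V)}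
        {b | E b y ∧ b ∈ ({x, y}ᶜ : Set V)} S →
        ∃ p, IsDipath E x y p ∧ ∀ z ∈ p, z ∈ S ∪ {x, y} := by
      rintro S ⟨a, b, ha, haS, hb, hab⟩
      have hbS := RsE_mem haS hab
      refine exists_dipath (Or.inr (Or.inr rfl)) ?_
      refine Relation.ReflTransGen.head ⟨ha.1, Or.inr (Or.inl rfl), Or.inl haS⟩
        (Relation.ReflTransGen.tail ?_ ⟨hb.1, Or.inl hbS, Or.inr (Or.inr rfl)⟩)
      exact RsE_mono (fun _ _ h => h.1) Set.subset_union_left hab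
    obtain ⟨p, hp, hpS⟩ := build S hS
    obtain ⟨q, hq, hqT⟩ := build T hT
    have hpq : ∀ z, z ∈ p → z ∈ q → z = x ∨ z = y := by
      intro z h1 h2
      rcases hpS z h1 with h1 | h1
      · rcases hqT z h2 with h2 | h2
        · exact absurd h2 (Set.disjoint_left.1 hd h1)
        · exact h2
      · exact h1
    refine ⟨p, q, hp, hq, ?_, hpq⟩
    rintro rfl
    obtain ⟨p1, p2, p3, p4⟩ := hp
    match p, p1, p2, p3, p4, hpq with
    | [], _, p2, _, _, _ => simp at p2
    | [c], _, p2, p3, _, _ =>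
      simp at p2 p3
      exact hxy (p2 ▸ p3)
    | c :: d :: p, p1, p2, p3, p4, hpq =>
      simp at p2
      subst p2
      have hcd := (List.isChain_cons_cons.1 p1).1
      rcases hpq d (by simp) (by simp) with rfl | rfl
      · simp at p4
      · exact hE hcd

theorem rel2d_symm {E : V → V → Prop} {a b : V} (h : Rel2d E a b) : Rel2d E b a :=
  ⟨h.1.symm, h.2.2, h.2.1⟩

theorem rel2d_avoid {E : V → V → Prop} {a b w : V} (h : Rel2d E a b) (ha : w ≠ a)
    (hb : w ≠ b) : InSameSCC (RsE E {w}ᶜ) a b :=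
  ⟨h.2.1.avoid ha hb, h.2.2.avoid hb ha⟩

theorem cycle_rel [Finite V] {E : V → V → Prop} (l : ℕ) (u : ℕ → V)
    (hinj : ∀ i j, i ≤ l → j ≤ l → u i = u j → i = j)
    (hcyc : Rel2d E (u 0) (u l)) (hchain : ∀ i, i < l → Rel2d E (u i) (u (i + 1)))
    (i j : ℕ) (hij : i < j) (hj : j ≤ l) : Rel2d E (u i) (u j) := by
  by_contra hnot
  have hne : u i ≠ u j := fun h => hij.ne (hinj _ _ (by omega) hj h)
  have htr : ∀ (F : V → V → Prop) a b c, InSameSCC F a b → InSameSCC F b c → InSameSCC F a c :=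
    fun F a b c h1 h2 => ⟨h1.1.trans h2.1, h2.2.trans h1.2⟩
  -- general chain lemma
  have hgen : ∀ (F : V → V → Prop) m n, m ≤ n →
      (∀ k, m ≤ k → k < n → InSameSCC F (u k) (u (k + 1))) → InSameSCC F (u m) (u n) := by
    intro F m n hmn
    induction n, hmn using Nat.le_induction with
    | base => intro _; exact ⟨.refl, .refl⟩
    | succ n hmn ih =>
      intro h
      exact htr F _ _ _ (ih fun k h1 h2 => h k h1 (by omega)) (h n hmn (by omega))
  have hW : ∀ w, w ≠ u i → w ≠ u j → InSameSCC (RsE E {w}ᶜ) (u i) (u j) := by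
    intro w hwi hwj
    by_cases hk : ∃ k, i < k ∧ k < j ∧ w = u k
    · obtain ⟨k, hik, hkj, rfl⟩ := hk
      have hdiff : ∀ t, t ≤ l → t ≠ k → u k ≠ u t := fun t ht htk h =>
        htk (hinj _ _ (by omega) ht h).symm
      have h1 := hgen (RsE E {u k}ᶜ) 0 i (by omega) fun t _ ht =>
        rel2d_avoid (hchain t (by omega)) (hdiff _ (by omega) (by omega))
          (hdiff _ (by omega) (by omega))
      have h2 := hgen (RsE E {u k}ᶜ) j l (by omega) fun t _ ht =>
        rel2d_avoid (hchain t (by omega)) (hdiff _ (by omega) (by omega))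
          (hdiff _ (by omega) (by omega))
      have h3 := rel2d_avoid hcyc (hdiff 0 (by omega) (by omega)) (hdiff l (by omega) (by omega))
      exact htr _ _ _ _ ⟨h1.2, h1.1⟩ (htr _ _ _ _ h3 ⟨h2.2, h2.1⟩)
    · have hdiff : ∀ t, i ≤ t → t ≤ j → w ≠ u t := by
        intro t h1 h2 h3
        rcases h1.eq_or_lt with rfl | h1
        · exact hwi h3
        rcases h2.eq_or_lt with rfl | h2
        · exact hwj h3
        exact hk ⟨t, h1, h2, h3⟩
      exact hgen _ i j hij.le fun t h1 h2 => rel2d_avoid (hchain t (by omega))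
        (hdiff _ (by omega) (by omega)) (hdiff _ (by omega) (by omega))
  have hEd : ∀ x y, x ≠ y → ¬ Rel2d E x y → ∀ a b, Rel2d E a b →
      InSameSCC (fun c d => E c d ∧ ¬ (c = x ∧ d = y)) a b := by
    intro x y hxy hn a b hab
    by_cases h1 : x ≠ a ∧ x ≠ b
    · have h := rel2d_avoid hab h1.1 h1.2
      have hm : ∀ c d, RsE E {x}ᶜ c d → E c d ∧ ¬ (c = x ∧ d = y) :=
        fun c d h => ⟨h.1, fun h0 => h.2.1 h0.1⟩
      exact ⟨rtg_mono h.1 hm, rtg_mono h.2 hm⟩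
    · have h2 : y ≠ a ∧ y ≠ b := by
        have hba := rel2d_symm hab
        constructor
        · rintro rfl
          by_cases hxb : x = b
          · exact hn (hxb ▸ hba)
          · exact h1 ⟨hxy, hxb⟩
        · rintro rfl
          by_cases hxa : x = a
          · exact hn (hxa ▸ hab)
          · exact h1 ⟨hxa, hxy⟩
      have h := rel2d_avoid hab h2.1 h2.2
      have hm : ∀ c d, RsE E {y}ᶜ c d → E c d ∧ ¬ (c = x ∧ d = y) :=
        fun c d h => ⟨h.1, fun h0 => h.2.2 h0.2⟩
      exact ⟨rtg_mono h.1 hm, rtg_mono h.2 hm⟩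
  apply hnot
  refine ⟨hne, twoVDP_of hne (fun w h1 h2 => (hW w h1 h2).1) ?_,
    twoVDP_of hne.symm (fun w h1 h2 => (hW w h2 h1).2) ?_⟩
  · exact (hgen _ i j hij.le fun t h1 h2 => hEd _ _ hne hnot _ _ (hchain t (by omega))).1
  · exact (hgen _ i j hij.le fun t h1 h2 => hEd _ _ hne.symm (fun h => hnot (rel2d_symm h))
      _ _ (hchain t (by omega))).2

/-- Lemma 4: if distinct vertices `v 0, …, v l` form a cycle under
`↔²`, then they all lie in one common 2-directed block. -/
theorem stmt3 {V : Type*} [Fintype V] (E : V → V → Prop)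
    (hirr : ∀ v, ¬ E v v) (hsc : IsStronglyConn E)
    (l : ℕ) (v : Fin (l + 1) → V) (hinj : Function.Injective v)
    (hcyc : Rel2d E (v 0) (v (Fin.last l)))
    (hchain : ∀ i : Fin l, Rel2d E (v i.castSucc) (v i.succ)) :
    ∃ C : Set V, IsMaxBlock (Rel2d E) 2 C ∧ ∀ i, v i ∈ C := by
  have hlt : ∀ i j : Fin (l + 1), i < j → Rel2d E (v i) (v j) := by
    intro i j hij
    have hu : ∀ k : Fin (l + 1), v k = v (Fin.ofNat (l + 1) k.1) := by
      intro k
      congr 1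
      ext
      simp [Nat.mod_eq_of_lt k.2]
    have hu' : ∀ k (hk : k < l + 1), v (Fin.ofNat (l + 1) k) = v ⟨k, hk⟩ :=
      fun k hk => (hu ⟨k, hk⟩).symm
    rw [hu i, hu j]
    refine cycle_rel l (fun k => v (Fin.ofNat (l + 1) k)) ?_ ?_ ?_ i.1 j.1 hij (by omega)
    · intro a b ha hb hab
      simp only [hu' a (by omega), hu' b (by omega)] at hab
      simpa using hinj hab
    · have := hcyc
      rw [hu (Fin.last l), hu 0] at this
      exact this
    · intro k hk
      have := hchain ⟨k, hk⟩
      rw [hu (Fin.castSucc _), hu (Fin.succ _)] at this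
      exact this
  have hP : ∀ x ∈ Set.range v, ∀ y ∈ Set.range v, x ≠ y → Rel2d E x y := by
    rintro _ ⟨i, rfl⟩ _ ⟨j, rfl⟩ hne
    rcases lt_trichotomy i j with h | rfl | h
    · exact hlt i j h
    · exact absurd rfl hne
    · exact rel2d_symm (hlt j i h)
  obtain ⟨C, hC, hmax⟩ := (Set.toFinite
    {D : Set V | ∀ x ∈ D, ∀ y ∈ D, x ≠ y → Rel2d E x y}).exists_le_maximal hP
  refine ⟨C, ⟨?_, hmax.1, ?_⟩, fun i => hC ⟨i, rfl⟩⟩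
  · rw [← Set.ncard_pair hcyc.1]
    refine Set.ncard_le_ncard ?_ (Set.toFinite _)
    rintro z (rfl | rfl)
    · exact hC ⟨_, rfl⟩
    · exact hC ⟨_, rfl⟩
  · intro D hD hDR
    exact (hmax.2 hDR hD).antisymm hD
end

section
/- Let G = (V,E) be a strongly connected finite simple directed graph and let v, w be two distinct vertices of G. Let G' = (V', E') be the directed graph obtained from G by subdividing every edge leaving v: for each edge e = (v,u) ∈ E, remove (v,u), add a new vertex x_e, and add the two edges (v, x_e) and (x_e, u). Then there exist two vertex-disjoint paths from v to w in G if and only if v is the immediate dominator of w in the flowgraph G'(v) = (V', E', v). -/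
variable {V : Type*}

/-- `u` is a dominator of `w` in the flowgraph with edge relation `E` and start `s`:
every path from `s` to `w` contains `u`. -/
def Dominates {α : Type*} (E : α → α → Prop) (s u w : α) : Prop :=
  ∀ p : List α, IsDipath E s w p → u ∈ p

/-- `u` is the immediate dominator of `w` in the flowgraph with start `s`:
`u ∈ dom(w) \ {w}` and every element of `dom(w) \ {w}` dominates `u`. -/
def ImmDom {α : Type*} (E : α → α → Prop) (s u w : α) : Prop :=
  Dominates E s u w ∧ u ≠ w ∧ ∀ z, Dominates E s z w → z ≠ w → Dominates E s z u

/-- The graph `G'` obtained from `G` by subdividing every edge leaving `v`: for each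
edge `(v,u)`, the edge is removed, a new vertex (represented by `Sum.inr ⟨u, _⟩`) is
added, together with the edges `(v, x_e)` and `(x_e, u)`. -/
def Subdiv (E : V → V → Prop) (v : V) :
    (V ⊕ {u : V // E v u}) → (V ⊕ {u : V // E v u}) → Prop
  | Sum.inl a, Sum.inl b => E a b ∧ a ≠ v
  | Sum.inl a, Sum.inr _ => a = v
  | Sum.inr u, Sum.inl b => b = u.1
  | Sum.inr _, Sum.inr _ => False

theorem rtg_lift {α β : Type*} {r : α → α → Prop} {t : β → β → Prop} (f : α → β)
    (h : ∀ a b, r a b → Relation.ReflTransGen t (f a) (f b)) {a b : α}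
    (p : Relation.ReflTransGen r a b) : Relation.ReflTransGen t (f a) (f b) := by
  induction p with
  | refl => exact Relation.ReflTransGen.refl
  | tail _ h2 ih => exact ih.trans (h _ _ h2)

theorem rtg_mono_s6 {α : Type*} {r t : α → α → Prop} {a b : α} (h : ∀ a b, r a b → t a b)
    (p : Relation.ReflTransGen r a b) : Relation.ReflTransGen t a b :=
  rtg_lift id (fun a b hab => Relation.ReflTransGen.single (h a b hab)) p

/-- reachability from `a` to `b` with all vertices after `a` in `S` -/
def Pt {α : Type*} (E : α → α → Prop) (S : Set α) (a b : α) : Prop :=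
  Relation.ReflTransGen (fun x y => E x y ∧ y ∈ S) a b

theorem Pt.mono {α : Type*} {E : α → α → Prop} {S T : Set α} {a b : α} (h : S ⊆ T)
    (p : Pt E S a b) : Pt E T a b :=
  rtg_mono_s6 (fun _ _ hh => ⟨hh.1, h hh.2⟩) p

theorem Pt.mem {α : Type*} {E : α → α → Prop} {S : Set α} {a b : α}
    (p : Pt E S a b) (h : b ≠ a) : b ∈ S := by
  rcases Relation.ReflTransGen.cases_tail p with h1 | ⟨c, _, h2⟩
  · exact absurd h1 h
  · exact h2.2

theorem Pt.core {α : Type*} {E : α → α → Prop} {S : Set α} {a b : α}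
    (p : Pt E S a b) : Pt E {z | z ∈ S ∧ Pt E {y | y ∈ S ∧ Pt E S y b} z b} a b := by
  have key : ∀ T : Set α, ∀ a, Pt E T a b → Pt E {z | z ∈ T ∧ Pt E T z b} a b := by
    intro T a p
    induction p using Relation.ReflTransGen.head_induction_on with
    | refl => exact Relation.ReflTransGen.refl
    | head h1 h2 ih => exact Relation.ReflTransGen.head ⟨h1.1, h1.2, h2⟩ ih
  refine (key _ _ (key _ _ p)).mono ?_
  rintro z ⟨⟨h1, _⟩, h2⟩
  exact ⟨h1, h2⟩

theorem Pt.core' {α : Type*} {E : α → α → Prop} {S : Set α} {a b : α}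
    (p : Pt E S a b) : ∃ T ⊆ S, Pt E T a b ∧ ∀ z ∈ T, Pt E T z b := by
  have key : ∀ a, Pt E S a b → Pt E {z | z ∈ S ∧ Pt E S z b} a b := by
    intro a p
    induction p using Relation.ReflTransGen.head_induction_on with
    | refl => exact Relation.ReflTransGen.refl
    | head h1 h2 ih => exact Relation.ReflTransGen.head ⟨h1.1, h1.2, h2⟩ ih
  exact ⟨{z | z ∈ S ∧ Pt E S z b}, fun z hz => hz.1, key _ p, fun z hz => key _ hz.2⟩

theorem Pt.trunc {α : Type*} {E : α → α → Prop} {S B : Set α} {a c : α}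
    (p : Pt E S a c) (hc : c ∈ B) (ha : a ∉ B) :
    ∃ r ∈ B, r ∈ S ∧ Pt E (S ∩ (Bᶜ ∪ {r})) a r := by
  induction p using Relation.ReflTransGen.head_induction_on with
  | refl => exact absurd hc ha
  | @head a d h1 h2 ih =>
    by_cases hd : d ∈ B
    · exact ⟨d, hd, h1.2, Relation.ReflTransGen.single ⟨h1.1, h1.2, Or.inr rfl⟩⟩
    · obtain ⟨r, hr, hrS, hp⟩ := ih hd
      exact ⟨r, hr, hrS, Relation.ReflTransGen.head ⟨h1.1, h1.2, Or.inl hd⟩ hp⟩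

theorem Pt.lastIn {α : Type*} {E : α → α → Prop} {S P : Set α} {a c : α}
    (p : Pt E S a c) (ha : a ∈ P) :
    ∃ x ∈ P, (x = a ∨ x ∈ S) ∧ Pt E (S \ P) x c := by
  have key : Pt E (S \ P) a c ∨ ∃ x ∈ P, x ∈ S ∧ Pt E (S \ P) x c := by
    clear ha
    induction p using Relation.ReflTransGen.head_induction_on with
    | refl => exact Or.inl Relation.ReflTransGen.refl
    | @head a d h1 h2 ih =>
      rcases ih with ih | ih
      · by_cases hd : d ∈ P
        · exact Or.inr ⟨d, hd, h1.2, ih⟩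
        · exact Or.inl (Relation.ReflTransGen.head ⟨h1.1, h1.2, hd⟩ ih)
      · exact Or.inr ih
  rcases key with h | ⟨x, h1, h2, h3⟩
  · exact ⟨a, ha, Or.inl rfl, h⟩
  · exact ⟨x, h1, Or.inr h2, h3⟩

theorem Pt.lastStep {α : Type*} {E : α → α → Prop} {S : Set α} {a w : α}
    (p : Pt E S a w) (ha : a ≠ w) :
    ∃ c, E c w ∧ Pt E (S \ {w}) a c := by
  induction p using Relation.ReflTransGen.head_induction_on with
  | refl => exact absurd rfl ha
  | @head a d h1 h2 ih =>
    by_cases hd : d = w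
    · exact ⟨a, hd ▸ h1.1, Relation.ReflTransGen.refl⟩
    · obtain ⟨c, hc, hp⟩ := ih hd
      exact ⟨c, hc, Relation.ReflTransGen.head ⟨h1.1, h1.2, hd⟩ hp⟩

theorem pt_of_chain {α : Type*} {E : α → α → Prop} (l : List α) : ∀ a b : α,
    List.IsChain E (a :: l) → (a :: l).getLast? = some b → Pt E {y | y ∈ l} a b := by
  induction l with
  | nil =>
    intro a b _ h
    simp at h
    subst h
    exact Relation.ReflTransGen.refl
  | cons d l ih =>
    intro a b h1 h2
    rw [List.isChain_cons_cons] at h1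
    rw [List.getLast?_cons_cons] at h2
    exact Relation.ReflTransGen.head ⟨h1.1, by simp⟩
      ((ih d b h1.2 h2).mono (fun y hy => by simp at hy ⊢; exact Or.inr hy))

theorem chain_of_pt {α : Type*} {E : α → α → Prop} {S : Set α} {a b : α}
    (p : Pt E S a b) : ∃ l : List α, List.IsChain E (a :: l) ∧ (a :: l).getLast? = some b ∧
      (a :: l).Nodup ∧ ∀ y ∈ l, y ∈ S := by
  induction p with
  | refl => exact ⟨[], by simp⟩
  | @tail c d h1 h2 ih =>
    obtain ⟨l, hl1, hl2, hl3, hl4⟩ := ih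
    by_cases hd : d ∈ a :: l
    · rcases List.mem_cons.1 hd with h | h
      · subst h
        exact ⟨[], by simp⟩
      · obtain ⟨s, t, rfl⟩ := List.append_of_mem h
        have e : a :: (s ++ d :: t) = (a :: (s ++ [d])) ++ t := by simp
        refine ⟨s ++ [d], ?_, ?_, ?_, ?_⟩
        · rw [e] at hl1; exact hl1.left_of_append
        · rw [← List.cons_append, List.getLast?_concat]
        · rw [e] at hl3; exact hl3.of_append_left
        · intro y hy; apply hl4; simp at hy ⊢; tauto
    · refine ⟨l ++ [d], ?_, ?_, ?_, ?_⟩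
      · rw [← List.cons_append]
        refine List.isChain_append.2 ⟨hl1, by simp, ?_⟩
        intro x hx y hy
        rw [hl2] at hx
        simp at hx hy
        subst hx hy
        exact h2.1
      · rw [← List.cons_append, List.getLast?_concat]
      · rw [← List.cons_append]
        refine List.Nodup.append hl3 (by simp) ?_
        intro x hx hx'
        simp at hx'
        subst hx'
        exact hd hx
      · intro y hy
        simp at hy
        rcases hy with hy | rfl
        · exact hl4 y hy
        · exact h2.2

/-- Menger theorem for two paths, from a vertex to a set. -/
theorem menger_two_s6 {α : Type*} [Finite α] (E : α → α → Prop) (s : α) (n : ℕ) :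
    ∀ (B X : Set α) (b : α), Bᶜ.ncard ≤ n → s ∉ B → b ∈ B → Pt E X s b → X ∩ B ⊆ {b} →
    (∀ z, z ≠ s → ∃ c ∈ B, Pt E {z}ᶜ s c) →
    ∃ (X' Y' : Set α) (c : α), c ∈ B ∧ c ≠ b ∧ Pt E X' s b ∧ Pt E Y' s c ∧
      X' ∩ B ⊆ {b} ∧ Y' ∩ B ⊆ {c} ∧ X' ∩ Y' ⊆ ∅ ∧ s ∉ X' ∧ s ∉ Y' := by
  induction n with
  | zero =>
    intro B X b hn hs
    have : Bᶜ = ∅ := by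
      rw [← Set.ncard_eq_zero (Set.toFinite _)]; omega
    exact absurd (show s ∈ Bᶜ from hs) (by simp [this])
  | succ n ih =>
    intro B X b hn hs hb hX hXB hsep
    have hbs : b ≠ s := fun h => hs (h ▸ hb)
    obtain ⟨c0, hc0, hp0⟩ := hsep b hbs
    obtain ⟨r, hrB, hrb, hR⟩ := hp0.trunc hc0 hs
    have hrb : r ≠ b := hrb
    obtain ⟨l, hl1, hl2, hl3, hl4⟩ := chain_of_pt hX
    have hlb : ∀ y ∈ l, y ∈ B → y = b := fun y hy hyB => hXB ⟨hl4 y hy, hyB⟩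
    obtain ⟨x, hxP, hxS, hxr⟩ := hR.lastIn (P := {y | y ∈ s :: l}) (by simp)
    obtain ⟨T, hTS, hT, hTr⟩ := hxr.core'
    have hT1 : ∀ y ∈ T, y ∈ B → y = r := by
      intro y hy hyB
      rcases (hTS hy).1.2 with h | h
      · exact absurd hyB h
      · exact h
    have hT2 : ∀ y ∈ T, y ≠ s ∧ y ∉ l := by
      intro y hy
      have := (hTS hy).2
      simpa [not_or] using this
    by_cases hxs : x = s
    · subst hxs
      refine ⟨{y | y ∈ l}, T, r, hrB, hrb, pt_of_chain l _ _ hl1 hl2, hT, ?_, ?_, ?_, ?_, ?_⟩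
      · rintro y ⟨h1, h2⟩; exact hlb y h1 h2
      · rintro y ⟨h1, h2⟩; exact hT1 y h1 h2
      · rintro y ⟨h1, h2⟩; exact (hT2 y h2).2 h1
      · exact (List.nodup_cons.1 hl3).1
      · intro h; exact (hT2 _ h).1 rfl
    · have hxb : x ≠ b := by
        rcases hxS with h | h
        · exact absurd h hxs
        · exact h.1
      have hxl : x ∈ l := by
        rcases List.mem_cons.1 hxP with h | h
        · exact absurd h hxs
        · exact h
      obtain ⟨l1, l2, rfl⟩ := List.append_of_mem hxl
      have e : s :: (l1 ++ x :: l2) = (s :: (l1 ++ [x])) ++ l2 := by simp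
      have hp1 : Pt E {y | y ∈ l1 ++ [x]} s x := by
        apply pt_of_chain
        · rw [e] at hl1; exact hl1.left_of_append
        · rw [← List.cons_append, List.getLast?_concat]
      have hp2 : Pt E {y | y ∈ l2} x b := by
        apply pt_of_chain
        · rw [← List.cons_append] at hl1; exact hl1.right_of_append
        · rw [← List.cons_append, List.getLast?_append] at hl2
          simpa [List.getLast?_cons] using hl2
      obtain ⟨Q, hQS, hQ, hQb⟩ := hp2.core'
      have hbQ : b ∈ Q := hQ.mem (Ne.symm hxb)
      have hnd : s ∉ l1 ∧ s ∉ l2 ∧ x ∉ l1 ∧ x ∉ l2 ∧ ∀ y ∈ l1, y ∉ l2 := by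
        simp [List.nodup_append] at hl3
        grind
      obtain ⟨hs1, hs2, hx1, hx2, h12⟩ := hnd
      have hQ2 : ∀ y ∈ Q, y ∈ l2 := fun y hy => hQS hy
      have hT3 : ∀ y ∈ T, y ≠ s ∧ y ≠ x ∧ y ∉ l1 ∧ y ∉ l2 := by
        intro y hy
        have := hT2 y hy
        simp at this
        tauto
      have hxB : x ∉ B := fun h => hxb (hlb x hxl h)
      have hlb2 : ∀ y ∈ l2, y ∈ B → y = b := fun y hy => hlb y (by simp [hy])
      have hlb1 : ∀ y ∈ l1, y ∉ B := by
        intro y hy hyB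
        have := hlb y (by simp [hy]) hyB
        subst this
        exact h12 _ hy (hQ2 _ hbQ)
      have hcard : (B ∪ {x} ∪ Q ∪ T)ᶜ.ncard ≤ n := by
        have : (B ∪ {x} ∪ Q ∪ T)ᶜ.ncard < Bᶜ.ncard := by
          apply Set.ncard_lt_ncard _ (Set.toFinite _)
          rw [Set.ssubset_iff_of_subset]
          · exact ⟨x, hxB, by simp⟩
          · intro y hy hyB
            exact hy (by simp [hyB])
        omega
      obtain ⟨X', Y', y, hyB, hyx, hX', hY', hXB', hYB', hdis, hsX, hsY⟩ :=
        ih (B ∪ {x} ∪ Q ∪ T) {y | y ∈ l1 ++ [x]} x hcard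
          (by
            rintro (((h | h) | h) | h)
            · exact hs h
            · exact hxs h.symm
            · exact hs2 (hQ2 _ h)
            · exact (hT3 _ h).1 rfl)
          (by simp) hp1
          (by
            rintro z ⟨h1, h2⟩
            simp at h1
            rcases h1 with h1 | h1
            · exfalso
              rcases h2 with ((h | h) | h) | h
              · exact hlb1 z h1 h
              · exact hx1 (h ▸ h1)
              · exact h12 z h1 (hQ2 _ h)
              · exact (hT3 _ h).2.2.1 h1
            · exact h1)
          (by
            intro z hz
            obtain ⟨c, hc, hp⟩ := hsep z hz
            exact ⟨c, by simp [hc], hp⟩)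
      have hX1 : ∀ z ∈ X', z ∉ B := fun z hz h => by
        have : z = x := hXB' ⟨hz, by simp [h]⟩
        exact hxB (this ▸ h)
      have hX2 : ∀ z ∈ X', z ∉ Q := fun z hz h => by
        have : z = x := hXB' ⟨hz, by simp [h]⟩
        exact hx2 (this ▸ hQ2 _ h)
      have hX3 : ∀ z ∈ X', z ∉ T := fun z hz h => by
        have : z = x := hXB' ⟨hz, by simp [h]⟩
        exact (hT3 _ h).2.1 this
      have hY1 : ∀ z ∈ Y', z ∈ B → z = y := fun z hz h => hYB' ⟨hz, by simp [h]⟩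
      have hY2 : ∀ z ∈ Y', z ∈ Q → z = y := fun z hz h => hYB' ⟨hz, by simp [h]⟩
      have hY3 : ∀ z ∈ Y', z ∈ T → z = y := fun z hz h => hYB' ⟨hz, by simp [h]⟩
      have hXY : ∀ z ∈ X', z ∉ Y' := fun z hz h => hdis ⟨hz, h⟩
      have hsQ : s ∉ Q := fun h => hs2 (hQ2 _ h)
      have hsT : s ∉ T := fun h => (hT3 _ h).1 rfl
      have hTQ : ∀ z ∈ T, z ∉ Q := fun z hz h => (hT3 z hz).2.2.2 (hQ2 _ h)
      have hQB : ∀ z ∈ Q, z ∈ B → z = b := fun z hz => hlb2 z (hQ2 z hz)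
      have comp : ∀ {S1 S2 : Set α} {a b c : α}, Pt E S1 a b → Pt E S2 b c →
          Pt E (S1 ∪ S2) a c := fun h1 h2 =>
        Relation.ReflTransGen.trans (h1.mono Set.subset_union_left)
          (h2.mono Set.subset_union_right)
      by_cases hyQ : y ∈ Q
      · refine ⟨Y' ∪ Q, X' ∪ T, r, hrB, hrb, comp hY' (hQb y hyQ), comp hX' hT, ?_⟩
        refine ⟨?_, ?_, ?_, ?_, ?_⟩
        · rintro z ⟨h1 | h1, h2⟩
          · have := hY1 z h1 h2
            exact hQB z (this ▸ hyQ) h2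
          · exact hQB z h1 h2
        · rintro z ⟨h1 | h1, h2⟩
          · exact absurd h2 (hX1 z h1)
          · exact hT1 z h1 h2
        · rintro z ⟨h1 | h1, h2 | h2⟩
          · exact hXY z h2 h1
          · exact hTQ z h2 (hY3 z h1 h2 ▸ hyQ)
          · exact hX2 z h2 h1
          · exact hTQ z h2 h1
        · rintro (h | h) <;> contradiction
        · rintro (h | h) <;> contradiction
      · have hYQ : ∀ z ∈ Y', z ∉ Q := fun z h1 h2 => hyQ (hY2 z h1 h2 ▸ h2)
        by_cases hyT : y ∈ T
        · refine ⟨X' ∪ Q, Y' ∪ T, r, hrB, hrb, comp hX' hQ, comp hY' (hTr y hyT), ?_⟩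
          refine ⟨?_, ?_, ?_, ?_, ?_⟩
          · rintro z ⟨h1 | h1, h2⟩
            · exact absurd h2 (hX1 z h1)
            · exact hQB z h1 h2
          · rintro z ⟨h1 | h1, h2⟩
            · exact hT1 z (hY1 z h1 h2 ▸ hyT) h2
            · exact hT1 z h1 h2
          · rintro z ⟨h1 | h1, h2 | h2⟩
            · exact hXY z h1 h2
            · exact hX3 z h1 h2
            · exact hYQ z h2 h1
            · exact hTQ z h2 h1
          · rintro (h | h) <;> contradiction
          · rintro (h | h) <;> contradiction
        · have hyB2 : y ∈ B := by
            rcases hyB with ((h | h) | h) | h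
            · exact h
            · exact absurd h hyx
            · exact absurd h hyQ
            · exact absurd h hyT
          refine ⟨X' ∪ Q, Y', y, hyB2, fun h => hyQ (h ▸ hbQ), comp hX' hQ, hY', ?_⟩
          refine ⟨?_, ?_, ?_, ?_, ?_⟩
          · rintro z ⟨h1 | h1, h2⟩
            · exact absurd h2 (hX1 z h1)
            · exact hQB z h1 h2
          · rintro z ⟨h1, h2⟩
            exact hY1 z h1 h2
          · rintro z ⟨h1 | h1, h2⟩
            · exact hXY z h1 h2
            · exact hYQ z h2 h1
          · rintro (h | h) <;> contradiction
          · exact hsY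

theorem lift_path {V : Type*} {E : V → V → Prop} {v w : V} (hvw : v ≠ w) {p : List V}
    (hp : IsDipath E v w p) : ∃ (u : V) (t : List V) (h : E v u), p = v :: u :: t ∧
      IsDipath (Subdiv E v) (Sum.inl v) (Sum.inl w)
        (Sum.inl v :: Sum.inr ⟨u, h⟩ :: (u :: t).map Sum.inl) := by
  obtain ⟨h1, h2, h3, h4⟩ := hp
  rcases p with _ | ⟨a, _ | ⟨u, t⟩⟩
  · simp at h2
  · simp at h2 h3
    exact absurd (h2.symm.trans h3) hvw
  · simp at h2
    subst h2
    have h1 : List.IsChain E (a :: u :: t) := h1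
    rw [List.isChain_cons_cons] at h1
    have hmap : ∀ l : List V, a ∉ l → List.IsChain E l →
        List.IsChain (Subdiv E a) (l.map Sum.inl) := by
      intro l
      induction l with
      | nil => simp
      | cons x l ih =>
        intro hx hl
        cases l with
        | nil => simp
        | cons y l =>
          rw [List.isChain_cons_cons] at hl
          simp only [List.map_cons, List.isChain_cons_cons]
          refine ⟨⟨hl.1, fun h => hx (by simp [h])⟩, ?_⟩
          have := ih (fun h => hx (List.mem_cons_of_mem _ h)) hl.2
          simpa using this
    refine ⟨u, t, h1.1, rfl, ?_, rfl, ?_, ?_⟩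
    · have := hmap (u :: t) (List.nodup_cons.1 h4).1 h1.2
      show List.IsChain _ _
      simp only [List.map_cons, List.isChain_cons_cons] at this ⊢
      exact ⟨rfl, rfl, this⟩
    · rw [List.getLast?_cons_cons] at h3
      rw [List.getLast?_cons_cons, List.map_cons, List.getLast?_cons_cons, ← List.map_cons,
        List.getLast?_map, h3]
      rfl
    · have h5 : ((u :: t).map (Sum.inl : V → V ⊕ {u : V // E a u})).Nodup :=
        (List.nodup_cons.1 h4).2.map Sum.inl_injective
      have h6 := (List.nodup_cons.1 h4).1
      rw [List.nodup_cons, List.nodup_cons]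
      refine ⟨?_, ?_, h5⟩
      · simp at h6 ⊢; exact h6
      · simp

theorem rtg_of_dipath {α : Type*} {E : α → α → Prop} {x y : α} {p : List α}
    (hp : IsDipath E x y p) :
    Relation.ReflTransGen (fun a b => E a b ∧ a ∈ p ∧ b ∈ p) x y := by
  obtain ⟨h1, h2, h3, -⟩ := hp
  have h1 : List.IsChain E p := h1
  have key : ∀ (l : List α) (x : α), List.IsChain E l → l.head? = some x →
      l.getLast? = some y → (∀ z ∈ l, z ∈ p) →
      Relation.ReflTransGen (fun a b => E a b ∧ a ∈ p ∧ b ∈ p) x y := by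
    intro l
    induction l with
    | nil => simp
    | cons a l ih =>
      intro x h1 h2 h3 h4
      simp at h2
      subst h2
      cases l with
      | nil => simp at h3; subst h3; exact Relation.ReflTransGen.refl
      | cons d l =>
        rw [List.isChain_cons_cons] at h1
        rw [List.getLast?_cons_cons] at h3
        exact Relation.ReflTransGen.head ⟨h1.1, h4 _ (by simp), h4 _ (by simp)⟩
          (ih d h1.2 rfl h3 (fun z hz => h4 z (List.mem_cons_of_mem _ hz)))
  exact key p x h1 h2 h3 (fun _ h => h)

/-- projection of the subdivided graph -/
def prj {V : Type*} {E : V → V → Prop} (v : V) : V ⊕ {u : V // E v u} → V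
  | Sum.inl a => a
  | Sum.inr _ => v

theorem proj_path {V : Type*} {E : V → V → Prop} {v w : V}
    {p : List (V ⊕ {u : V // E v u})}
    (hp : IsDipath (Subdiv E v) (Sum.inl v) (Sum.inl w) p) :
    Relation.ReflTransGen (fun a b => E a b ∧ Sum.inl b ∈ p ∧
      (a = v → ∃ h : E v b, Sum.inr ⟨b, h⟩ ∈ p)) v w := by
  refine rtg_lift (prj v) ?_ (rtg_of_dipath hp)
  rintro (a | a) (b | b) ⟨h1, h2, h3⟩
  · exact Relation.ReflTransGen.single ⟨h1.1, h3, fun h => absurd h h1.2⟩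
  · have : a = v := h1
    subst this
    exact Relation.ReflTransGen.refl
  · have : b = a.1 := h1
    subst this
    exact Relation.ReflTransGen.single ⟨a.2, h3, fun _ => ⟨a.2, h2⟩⟩
  · exact absurd h1 (by simp [Subdiv])

theorem dipath_snoc {V : Type*} {E : V → V → Prop} {v w b : V} {X : Set V} (hvw : v ≠ w)
    (hX : Pt (fun x y => E x y ∧ y ≠ w) X v b) (hb : E b w) :
    ∃ l : List V, IsDipath E v w (v :: (l ++ [w])) ∧ (∀ y ∈ l, y ∈ X ∧ y ≠ w) ∧
      (b ≠ v → b ∈ l) := by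
  have hX' : Pt E (X ∩ {w}ᶜ) v b :=
    rtg_mono_s6 (fun _ _ h => ⟨h.1.1, h.2, h.1.2⟩) hX
  obtain ⟨l, h1, h2, h3, h4⟩ := chain_of_pt hX'
  have hw : w ∉ v :: l := by
    intro h
    rcases List.mem_cons.1 h with h | h
    · exact hvw h.symm
    · exact (h4 w h).2 rfl
  refine ⟨l, ⟨?_, rfl, ?_, ?_⟩, fun y hy => h4 y hy, ?_⟩
  · show List.IsChain _ _
    rw [← List.cons_append]
    refine List.isChain_append.2 ⟨h1, by simp, ?_⟩
    intro x hx y hy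
    rw [h2] at hx
    simp at hx hy
    subst hx hy
    exact hb
  · rw [← List.cons_append, List.getLast?_concat]
  · rw [← List.cons_append]
    refine List.Nodup.append h3 (by simp) ?_
    intro x hx hx'
    simp at hx'
    subst hx'
    exact hw hx
  · intro hbv
    have := List.mem_of_getLast? h2
    rcases List.mem_cons.1 this with h | h
    · exact absurd h hbv
    · exact h

/-- Lemma 6: there are two vertex-disjoint paths from `v` to `w` in `G`
iff `v` is the immediate dominator of `w` in the flowgraph `G'(v)` obtained by
subdividing the edges leaving `v`. -/
theorem stmt6 {V : Type*} [Fintype V] (E : V → V → Prop)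
    (hirr : ∀ u, ¬ E u u) (hsc : IsStronglyConn E) (v w : V) (hvw : v ≠ w) :
    TwoVDP E v w ↔ ImmDom (Subdiv E v) (Sum.inl v) (Sum.inl v) (Sum.inl w) := by
  constructor
  · rintro ⟨p, q, hp, hq, hpq, hdis⟩
    refine ⟨fun l hl => List.mem_of_mem_head? hl.2.1, by simpa using hvw, ?_⟩
    intro z hz hzw
    suffices z = Sum.inl v by
      subst this
      exact fun l hl => List.mem_of_mem_head? hl.2.1
    obtain ⟨u, t, hu, rfl, hp'⟩ := lift_path hvw hp
    obtain ⟨u', t', hu', rfl, hq'⟩ := lift_path hvw hq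
    have m1 := hz _ hp'
    have m2 := hz _ hq'
    rcases z with a | a
    · have ha : a = v ∨ a = w := hdis a (by simpa using m1) (by simpa using m2)
      rcases ha with rfl | rfl
      · rfl
      · exact absurd rfl hzw
    · exfalso
      have e1 : a.1 = u := by simp at m1; rw [m1]
      have e2 : a.1 = u' := by simp at m2; rw [m2]
      have e : u = u' := e1.symm.trans e2
      subst e
      rcases hdis u (by simp) (by simp) with h | h
      · subst h; exact hirr _ hu
      · subst h
        have key : ∀ t : List V, IsDipath E v u (v :: u :: t) → t = [] := by
          rintro t ⟨-, -, h3, h4⟩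
          rcases t with _ | ⟨d, t⟩
          · rfl
          · exfalso
            rw [List.getLast?_cons_cons, List.getLast?_cons_cons] at h3
            have := List.mem_of_getLast? h3
            exact (List.nodup_cons.1 (List.nodup_cons.1 h4).2).1 this
        exact hpq (by rw [key t hp, key t' hq])
  · rintro ⟨-, -, hdom⟩
    have avoid : ∀ z, z ≠ Sum.inl v → z ≠ Sum.inl w →
        ∃ p, IsDipath (Subdiv E v) (Sum.inl v) (Sum.inl w) p ∧ z ∉ p := by
      intro z h1 h2
      by_contra hcon
      push Not at hcon
      have := hdom z hcon h2 [Sum.inl v] ⟨by show List.IsChain _ _; simp, rfl, rfl, by simp⟩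
      simp at this
      exact h1 this
    by_cases hE : E v w
    · obtain ⟨p, hp, hz⟩ := avoid (Sum.inr ⟨w, hE⟩) (by simp) (by simp)
      have h := proj_path hp
      have h' : Pt (fun a b => E a b ∧ ¬ (a = v ∧ b = w)) Set.univ v w := by
        refine rtg_mono_s6 ?_ h
        rintro a b ⟨h1, _, h3⟩
        refine ⟨⟨h1, ?_⟩, trivial⟩
        rintro ⟨ha, rfl⟩
        obtain ⟨_, h⟩ := h3 ha
        exact hz h
      obtain ⟨l, h1, h2, h3, _⟩ := chain_of_pt h'
      refine ⟨v :: l, [v, w], ⟨?_, rfl, h2, h3⟩, ⟨?_, rfl, rfl, by simpa using hvw⟩, ?_, ?_⟩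
      · exact h1.imp (fun _ _ h => h.1)
      · show List.IsChain _ _
        simpa using hE
      · intro e
        rw [e] at h1
        simp at h1
      · intro z _ hz
        simpa using hz
    · have hB : v ∉ {c | E c w} := hE
      have step : ∀ S : Set V, Pt E S v w →
          ∃ c ∈ {c | E c w}, Pt (fun x y => E x y ∧ y ≠ w) S v c := by
        intro S h
        obtain ⟨c, hc, hp⟩ := h.lastStep hvw
        exact ⟨c, hc, rtg_mono_s6 (fun _ _ h => ⟨⟨h.1, h.2.2⟩, h.2.1⟩) hp⟩
      have h0 : Pt E Set.univ v w :=
        rtg_mono_s6 (fun _ _ h => ⟨h, trivial⟩) (hsc v w)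
      obtain ⟨c0, hc0, hp0⟩ := step _ h0
      obtain ⟨b, hb, -, hpb⟩ := hp0.trunc hc0 hB
      obtain ⟨X, Y, c, hc, hcb, hX, hY, -, -, hXY, hvX, hvY⟩ :=
        menger_two_s6 (fun x y => E x y ∧ y ≠ w) v _ {c | E c w} _ b le_rfl hB hb hpb
          (by
            rintro y ⟨⟨_, h | h⟩, h2⟩
            · exact absurd h2 h
            · exact h)
          (by
            intro z hz
            by_cases hzw : z = w
            · subst hzw
              refine ⟨c0, hc0, ?_⟩
              exact rtg_mono_s6 (fun _ _ h => ⟨h.1, h.1.2⟩) hp0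
            · obtain ⟨p, hp, hzp⟩ := avoid (Sum.inl z) (by simpa using hz) (by simpa using hzw)
              apply step
              refine rtg_mono_s6 ?_ (proj_path hp)
              rintro x y ⟨h1, h2, _⟩
              refine ⟨h1, ?_⟩
              rintro rfl
              exact hzp h2)
      obtain ⟨l1, hl1, hm1, hb1⟩ := dipath_snoc hvw hX hb
      obtain ⟨l2, hl2, hm2, _⟩ := dipath_snoc hvw hY hc
      have hbl : b ∈ l1 := hb1 (fun h => hB (h ▸ hb))
      have hd : ∀ z ∈ l1, z ∉ l2 := fun z h1 h2 => hXY ⟨(hm1 z h1).1, (hm2 z h2).1⟩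
      refine ⟨_, _, hl1, hl2, ?_, ?_⟩
      · intro e
        simp at e
        exact hd b hbl (e ▸ hbl)
      · intro z h1 h2
        simp at h1 h2
        have := hd z
        tauto
end
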